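/- For the weights λ_N = +1 at the north pole and λ_S = -1 at the south pole of the rotation action of S¹ on S², with moment map values μ(N) = 1 and μ(S) = -1 and polarization ξ = -1, the Fourier transform of the hyperfunction (1/2πi)·b_γ(-e^{iz}/z + e^{-iz}/(-z)) (γ the lower half plane) is the hyperfunction b₊(-(1/2πi)Log((ζ-1)/(ζ+1))) - b₋(-(1/2πi)Log((ζ-1)/(ζ+1))), which is a standard defining hyperfunction of the indicator function χ_{[-1,1]}. -/

import Mathlib

open Complex Real MeasureTheory

lemma aux_int_abs {b : ℝ} (hb : 0 < b) : Integrable (fun x : ℝ => Real.exp (-b * |x|)) := by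
  rw [← integrableOn_univ, ← Set.Iic_union_Ioi (a := (0:ℝ)), integrableOn_union]
  constructor
  · refine (integrableOn_exp_mul_Iic hb 0).congr_fun (fun x hx => ?_) measurableSet_Iic
    simp only [abs_of_nonpos (Set.mem_Iic.1 hx)]; congr 1; ring
  · refine (integrableOn_exp_mul_Ioi (neg_lt_zero.2 hb) 0).congr_fun (fun x hx => ?_)
      measurableSet_Ioi
    simp only [abs_of_pos (Set.mem_Ioi.1 hx)]

lemma aux_norm (ζ : ℂ) (x : ℝ) : ‖Complex.exp (-I * ζ * x)‖ = Real.exp (ζ.im * x) := by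
  rw [Complex.norm_exp]; simp

lemma aux_T {k : ℝ → ℂ} {C : ℝ} (hk : Measurable k) (hC : ∀ x, ‖k x‖ ≤ C * Real.exp (-|x|))
    {ζ : ℂ} (hζ : |ζ.im| < 1) :
    Integrable (fun x : ℝ => k x * Complex.exp (-I * ζ * x)) ∧
    DifferentiableAt ℂ (fun ζ : ℂ => ∫ x : ℝ, k x * Complex.exp (-I * ζ * x)) ζ := by
  have hC0 : 0 ≤ C := by have := (norm_nonneg _).trans (hC 0); simpa using this
  set e := (1 - |ζ.im|) / 4 with he
  have he0 : 0 < e := by rw [he]; linarith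
  have hbd : ∀ z : ℂ, ‖z - ζ‖ < e → ∀ x : ℝ,
      ‖k x * Complex.exp (-I * z * x)‖ ≤ C * Real.exp (-(3 * e) * |x|) := by
    intro z hz x
    rw [norm_mul, aux_norm]
    have h1 : |z.im| ≤ |ζ.im| + e := by
      have := (Complex.abs_im_le_norm (z - ζ)).trans hz.le
      rw [Complex.sub_im] at this
      have h2 := abs_sub_abs_le_abs_sub z.im ζ.im
      linarith
    have h3 : z.im * x ≤ (|ζ.im| + e) * |x| := by
      calc z.im * x ≤ |z.im * x| := le_abs_self _
        _ = |z.im| * |x| := abs_mul _ _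
        _ ≤ _ := by gcongr
    calc ‖k x‖ * Real.exp (z.im * x) ≤ (C * Real.exp (-|x|)) * Real.exp ((|ζ.im| + e) * |x|) := by
          gcongr; exact hC x
      _ = _ := by
          rw [mul_assoc, ← Real.exp_add]; congr 2
          have : |ζ.im| = 1 - 4 * e := by rw [he]; ring
          rw [this]; ring
  have hmeas : ∀ z : ℂ, AEStronglyMeasurable (fun x : ℝ => k x * Complex.exp (-I * z * x)) volume :=
    fun z => (hk.mul (by fun_prop)).aestronglyMeasurable
  have hint : Integrable (fun x : ℝ => k x * Complex.exp (-I * ζ * x)) :=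
    ((aux_int_abs (b := 3 * e) (by positivity)).const_mul C).mono' (hmeas ζ)
      (Filter.Eventually.of_forall (hbd ζ (by simpa using he0)))
  refine ⟨hint, ?_⟩
  refine (hasDerivAt_integral_of_dominated_loc_of_deriv_le
    (F' := fun z x => k x * Complex.exp (-I * z * x) * (-I * x))
    (bound := fun x => C / e * Real.exp (-(2 * e) * |x|))
    (Metric.ball_mem_nhds ζ he0) (Filter.Eventually.of_forall hmeas) hint
    ((hk.mul (by fun_prop)).mul (by fun_prop)).aestronglyMeasurable ?_
    ((aux_int_abs (b := 2 * e) (by positivity)).const_mul _) ?_).2.differentiableAt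
  · refine Filter.Eventually.of_forall fun x z hz => ?_
    have h1 := hbd z (by simpa [dist_eq_norm] using hz) x
    have h2 : ‖-I * (x:ℂ)‖ = |x| := by simp
    rw [norm_mul, h2]
    have h3 : |x| ≤ Real.exp (e * |x|) / e := by
      rw [le_div_iff₀ he0]
      have := Real.add_one_le_exp (e * |x|); linarith
    calc _ ≤ C * Real.exp (-(3 * e) * |x|) * (Real.exp (e * |x|) / e) := by gcongr
      _ = C / e * (Real.exp (-(3 * e) * |x|) * Real.exp (e * |x|)) := by ring
      _ = _ := by rw [← Real.exp_add]; congr 2; ring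
  · refine Filter.Eventually.of_forall fun x z hz => ?_
    have : HasDerivAt (fun z : ℂ => -I * z * x) (-I * x) z := by
      simpa using ((hasDerivAt_id z).const_mul (-I)).mul_const (x:ℂ)
    simpa [mul_assoc] using (this.cexp.const_mul (k x))

lemma aux_log {ζ : ℂ} (h : ζ.im ≠ 0) :
    Complex.log ((ζ - 1) / (ζ + 1)) = Complex.log (ζ - 1) - Complex.log (ζ + 1) := by
  have h1 : ζ - 1 ≠ 0 := fun h' => h (by have := congrArg Complex.im h'; simpa using this)
  have h2 : ζ + 1 ≠ 0 := fun h' => h (by have := congrArg Complex.im h'; simpa using this)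
  have ha : (ζ + 1).arg ≠ π := fun h' => h (by
    have := (Complex.arg_eq_pi_iff.1 h').2; simpa using this)
  have hi : (ζ+1)⁻¹.arg = -(ζ+1).arg := by rw [Complex.arg_inv, if_neg ha]
  rw [div_eq_mul_inv, (Complex.log_mul_eq_add_log_iff h1 (inv_ne_zero h2)).2, Complex.log_inv _ ha,
    ← sub_eq_add_neg]
  rw [hi]
  rcases lt_or_gt_of_ne h with h | h
  · have a1 : (ζ - 1).arg < 0 := Complex.arg_neg_iff.2 (by simpa using h)
    have a2 : (ζ + 1).arg < 0 := Complex.arg_neg_iff.2 (by simpa using h)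
    have := Complex.neg_pi_lt_arg (ζ - 1)
    have := Complex.neg_pi_lt_arg (ζ + 1)
    constructor <;> linarith
  · have a1 : 0 ≤ (ζ - 1).arg := Complex.arg_nonneg_iff.2 (by simpa using h.le)
    have a2 : 0 ≤ (ζ + 1).arg := Complex.arg_nonneg_iff.2 (by simpa using h.le)
    have := Complex.arg_le_pi (ζ - 1)
    have := lt_of_le_of_ne (Complex.arg_le_pi (ζ + 1)) ha
    constructor <;> linarith

lemma aux_Phi (δ : ℝ) : ∃ Φ : ℂ → ℂ, Differentiable ℂ Φ ∧
    ∀ u : ℂ, u ≠ 0 → HasDerivAt Φ ((Complex.exp (-u * δ) - 1) / u) u := by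
  have hd : Differentiable ℂ (dslope (fun u : ℂ => Complex.exp (-u * δ)) 0) := by
    rw [← differentiableOn_univ, Complex.differentiableOn_dslope Filter.univ_mem]
    exact Differentiable.differentiableOn (by fun_prop)
  obtain ⟨Φ, hΦ⟩ := hd.isExactOn_univ
  refine ⟨Φ, fun u => (hΦ u trivial).differentiableAt, fun u hu => ?_⟩
  have := hΦ u trivial
  rw [dslope_of_ne _ hu, slope_def_field] at this
  simpa using this

lemma aux_J {δ : ℝ} {Φ : ℂ → ℂ}
    (hΦ : ∀ u : ℂ, u ≠ 0 → HasDerivAt Φ ((Complex.exp (-u * δ) - 1) / u) u)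
    {ζ : ℂ} (h : ζ.im ≠ 0) :
    ∫ s in (-1:ℝ)..1, Complex.exp (-(ζ + s) * δ) / (ζ + s) =
      -Complex.log ((ζ - 1) / (ζ + 1)) + Φ (ζ + 1) - Φ (ζ - 1) := by
  have hne : ∀ s : ℝ, ζ + s ≠ 0 := fun s h' => h (by
    have := congrArg Complex.im h'; simpa using this)
  have hder : ∀ s : ℝ, HasDerivAt (fun s : ℝ => Complex.log (ζ + s) + Φ (ζ + s))
      (Complex.exp (-(ζ + s) * δ) / (ζ + s)) s := by
    intro s
    have h1 : HasDerivAt (fun s : ℝ => ζ + (s:ℂ)) 1 s :=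
      (Complex.ofRealCLM.hasDerivAt (x := s)).const_add ζ
    have h2 : HasDerivAt (fun u => Complex.log u + Φ u)
        ((ζ + s)⁻¹ + (Complex.exp (-(ζ + s) * δ) - 1) / (ζ + s)) (ζ + s) :=
      (Complex.hasDerivAt_log (Or.inr (by simpa using h))).add (hΦ _ (hne s))
    have h3 := HasDerivAt.comp (h₂ := fun u => Complex.log u + Φ u) s h2 h1
    convert! h3 using 1
    have := hne s
    field_simp; ring
  rw [intervalIntegral.integral_eq_sub_of_hasDerivAt (fun s _ => hder s)]
  · rw [aux_log h]; push_cast; ring_nf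
  · apply Continuous.intervalIntegrable
    exact Continuous.div (by fun_prop) (by fun_prop) hne

lemma aux_g {δ : ℝ} (hδ : 0 < δ) {ζ : ℂ} {S : Set ℝ} {c : ℂ}
    (hi : IntegrableOn (fun x : ℝ => Complex.exp (-I * ζ * x)) S)
    (hc : ∀ s : ℝ, ∫ x in S, Complex.exp (-I * (ζ + s) * x) = c / (ζ + s)) :
    let g : ℝ → ℂ := fun x => (-Complex.exp (-I * (ζ - 1) * ((x : ℂ) - I * δ)) +
          Complex.exp (-I * (ζ + 1) * ((x : ℂ) - I * δ))) / ((x : ℂ) - I * δ)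
    IntegrableOn g S ∧ ∫ x in S, g x =
      -I * c * ∫ s in (-1:ℝ)..1, Complex.exp (-(ζ + s) * δ) / (ζ + s) := by
  intro g
  set F : ℝ → ℝ → ℂ := fun x s => -I * Complex.exp (-I * (ζ + s) * ((x:ℂ) - I * δ)) with hF
  have hFeq : ∀ x s : ℝ, F x s = (-I * Complex.exp (-(ζ + s) * δ)) *
      Complex.exp (-I * (ζ + s) * x) := by
    intro x s
    rw [hF]; simp only
    rw [mul_assoc (-I) (Complex.exp (-(ζ + s) * δ)), ← Complex.exp_add]; congr 2
    linear_combination (ζ + s) * δ * Complex.I_sq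
  have hFint : Integrable (Function.uncurry F)
      ((volume.restrict S).prod (volume.restrict (Set.Ioc (-1:ℝ) 1))) := by
    have h1 : Integrable (fun s : ℝ => -I * Complex.exp (-(ζ + s) * δ))
        (volume.restrict (Set.Ioc (-1:ℝ) 1)) := by
      have : Continuous (fun s : ℝ => -I * Complex.exp (-(ζ + s) * δ)) := by fun_prop
      exact (this.integrableOn_Icc).mono_set Set.Ioc_subset_Icc_self
    have h2 := hi.mul_prod h1
    refine h2.mono (Continuous.aestronglyMeasurable (by simp only [hF]; fun_prop)) ?_
    refine Filter.Eventually.of_forall fun p => ?_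
    obtain ⟨x, s⟩ := p
    simp only [Function.uncurry, hFeq, norm_mul, aux_norm]
    simp
    rw [mul_comm]
  have hg : ∀ x : ℝ, ∫ s in Set.Ioc (-1:ℝ) 1, F x s = g x := by
    intro x
    have hw : (x:ℂ) - I * δ ≠ 0 := fun h' => hδ.ne' (by
      have := congrArg Complex.im h'; simpa using this)
    rw [← intervalIntegral.integral_of_le (by norm_num)]
    have hder : ∀ s : ℝ, HasDerivAt (fun s : ℝ =>
        Complex.exp (-I * (ζ + s) * ((x:ℂ) - I * δ)) / ((x:ℂ) - I * δ)) (F x s) s := by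
      intro s
      have h1 : HasDerivAt (fun s : ℝ => -I * (ζ + (s:ℂ)) * ((x:ℂ) - I * δ))
          (-I * 1 * ((x:ℂ) - I * δ)) s :=
        (((Complex.ofRealCLM.hasDerivAt (x := s)).const_add ζ).const_mul (-I)).mul_const _
      convert! (h1.cexp.div_const ((x:ℂ) - I * δ)) using 1
      rw [hF]; field_simp
    rw [intervalIntegral.integral_eq_sub_of_hasDerivAt (fun s _ => hder s)]
    · simp only [g]; push_cast; rw [← sub_eq_add_neg]; ring
    · apply Continuous.intervalIntegrable
      simp only [hF]; fun_prop
  constructor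
  · have := hFint.integral_prod_left
    simp only [Function.uncurry, hg] at this
    exact this
  · simp_rw [← hg]
    rw [integral_integral_swap hFint, intervalIntegral.integral_of_le (by norm_num),
      ← integral_const_mul]
    congr 1; ext s
    simp_rw [hFeq]
    rw [integral_const_mul, hc]; ring

lemma aux_den {δ : ℝ} (hδ0 : 0 < δ) (hδ1 : δ < 1) {w : ℂ} (hw : w.im = δ ∨ w.im = -δ) :
    0 < Real.cos δ ∧ 1 + Complex.exp w ≠ 0 ∧
      ‖((1 + Complex.exp w))⁻¹‖ ≤ (Real.cos δ)⁻¹ * Real.exp (-w.re) := by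
  have hc : 0 < Real.cos δ := Real.cos_pos_of_mem_Ioo
    ⟨by linarith [Real.pi_gt_three], by linarith [Real.pi_gt_three]⟩
  have hcos : Real.cos w.im = Real.cos δ := by
    rcases hw with h | h <;> rw [h]
    exact Real.cos_neg δ
  have h1 : Real.exp w.re * Real.cos δ < ‖1 + Complex.exp w‖ := by
    refine lt_of_lt_of_le ?_ (Complex.re_le_norm _)
    rw [Complex.add_re, Complex.exp_re, hcos]; simp
  have h0 : 0 < Real.exp w.re * Real.cos δ := by positivity
  refine ⟨hc, fun h => ?_, ?_⟩
  · rw [h, norm_zero] at h1; linarith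
  · rw [norm_inv, Real.exp_neg, ← mul_inv, mul_comm]
    exact inv_anti₀ h0 h1.le

theorem DH_hyperfunction_S2 (δ : ℝ) (hδ0 : 0 < δ) (hδ1 : δ < 1) :
    let Gp : ℂ → ℂ := fun ζ => (1 / (2 * (π : ℂ) * I)) *
      ∫ x : ℝ, (-Complex.exp (-I * (ζ - 1) * ((x : ℂ) - I * δ)) +
          Complex.exp (-I * (ζ + 1) * ((x : ℂ) - I * δ))) /
        (((x : ℂ) - I * δ) * (1 + Complex.exp ((x : ℂ) - I * δ)))
    let Gm : ℂ → ℂ := fun ζ => (1 / (2 * (π : ℂ) * I)) *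
      ∫ x : ℝ, (-Complex.exp (-I * (ζ - 1) * ((x : ℂ) - I * δ)) +
          Complex.exp (-I * (ζ + 1) * ((x : ℂ) - I * δ))) /
        (((x : ℂ) - I * δ) * (1 + Complex.exp (-((x : ℂ) - I * δ))))
    let h : ℂ → ℂ := fun ζ => -(1 / (2 * (π : ℂ) * I)) *
      Complex.log ((ζ - 1) / (ζ + 1))
    ∃ (Ω : Set ℂ) (H : ℂ → ℂ), IsOpen Ω ∧ (∀ x : ℝ, (x : ℂ) ∈ Ω) ∧
      DifferentiableOn ℂ H Ω ∧
      (∀ z ∈ Ω, 0 < z.im → H z = Gp z - h z) ∧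
      (∀ z ∈ Ω, z.im < 0 → H z = -(Gm z + h z)) := by
  intro Gp Gm h
  obtain ⟨Φ, hΦd, hΦ⟩ := aux_Phi δ
  set W : ℝ → ℂ := fun x => (x:ℂ) - I * δ with hW
  have hWre : ∀ x, (W x).re = x := fun x => by simp [hW]
  have hWim : ∀ x, (W x).im = -δ := fun x => by simp [hW]
  have hW0 : ∀ x, W x ≠ 0 := fun x h' => hδ0.ne' (by
    have := congrArg Complex.im h'; rw [hWim] at this; simpa using this)
  have hWn : ∀ x, ‖(W x)⁻¹‖ ≤ δ⁻¹ := fun x => by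
    rw [norm_inv]
    refine inv_anti₀ hδ0 ?_
    have := Complex.abs_im_le_norm (W x)
    rwa [hWim, abs_neg, abs_of_pos hδ0] at this
  have hp := fun x => aux_den hδ0 hδ1 (w := W x) (Or.inr (hWim x))
  have hm := fun x => aux_den hδ0 hδ1 (w := -W x) (Or.inl (by rw [Complex.neg_im, hWim, neg_neg]))
  set k : ℝ → ℂ := fun x => if 0 < x then (W x)⁻¹ * (1 + Complex.exp (W x))⁻¹
    else -((W x)⁻¹ * (1 + Complex.exp (-W x))⁻¹) with hk
  have hkm : Measurable k := by
    have hWm : Measurable W := by simp only [hW]; fun_prop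
    refine Measurable.ite measurableSet_Ioi ?_ ?_
    · exact hWm.inv.mul (by fun_prop)
    · exact (hWm.inv.mul (by fun_prop)).neg
  have hkb : ∀ x, ‖k x‖ ≤ (δ⁻¹ * (Real.cos δ)⁻¹) * Real.exp (-|x|) := by
    intro x
    rw [mul_assoc]
    by_cases hx : 0 < x
    · simp only [hk, if_pos hx, norm_mul]
      have h2 := (hp x).2.2
      rw [hWre] at h2
      rw [abs_of_pos hx]
      gcongr
      exact hWn x
    · simp only [hk, if_neg hx, norm_mul, norm_neg]
      have h2 := (hm x).2.2
      rw [Complex.neg_re, hWre] at h2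
      rw [abs_of_nonpos (not_lt.1 hx)]
      gcongr
      exact hWn x
  set T : ℂ → ℂ := fun ζ => ∫ x : ℝ, k x * Complex.exp (-I * ζ * x) with hT
  set N : ℂ → ℝ → ℂ := fun ζ x => -Complex.exp (-I * (ζ - 1) * W x) +
          Complex.exp (-I * (ζ + 1) * W x) with hN
  set A : ℂ → ℂ := fun ζ => -Complex.exp (-(ζ - 1) * δ) * T (ζ - 1) +
    Complex.exp (-(ζ + 1) * δ) * T (ζ + 1) with hA
  have hexp : ∀ (u : ℂ) (x : ℝ), Complex.exp (-I * u * W x) =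
      Complex.exp (-u * δ) * Complex.exp (-I * u * x) := by
    intro u x
    rw [← Complex.exp_add]; congr 1
    simp only [hW]
    linear_combination u * δ * Complex.I_sq
  have hNk : ∀ ζ : ℂ, |ζ.im| < 1 → Integrable (fun x => N ζ x * k x) ∧
      ∫ x, N ζ x * k x = A ζ := by
    intro ζ hζ
    have i1 := (aux_T hkm hkb (ζ := ζ - 1) (by simpa using hζ)).1.const_mul
      (-Complex.exp (-(ζ - 1) * δ))
    have i2 := (aux_T hkm hkb (ζ := ζ + 1) (by simpa using hζ)).1.const_mul
      (Complex.exp (-(ζ + 1) * δ))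
    have e : (fun x => N ζ x * k x) = fun x =>
        -Complex.exp (-(ζ - 1) * δ) * (k x * Complex.exp (-I * (ζ - 1) * x)) +
        Complex.exp (-(ζ + 1) * δ) * (k x * Complex.exp (-I * (ζ + 1) * x)) := by
      ext x
      simp only [hN, hexp]; ring
    rw [e]
    refine ⟨i1.add i2, ?_⟩
    rw [integral_add i1 i2, integral_const_mul, integral_const_mul]
  refine ⟨{z | |z.im| < 1}, fun ζ => (1 / (2 * (π : ℂ) * I)) * (A ζ + Φ (ζ + 1) - Φ (ζ - 1)),
    isOpen_lt (by fun_prop) (by fun_prop), fun x => by simp, ?_, ?_, ?_⟩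
  · intro ζ hζ
    have hζ : |ζ.im| < 1 := hζ
    apply DifferentiableAt.differentiableWithinAt
    have t1 : DifferentiableAt ℂ (fun ζ => T (ζ - 1)) ζ :=
      DifferentiableAt.comp (g := T) ζ
        (aux_T hkm hkb (ζ := ζ - 1) (by simpa using hζ)).2 (by fun_prop)
    have t2 : DifferentiableAt ℂ (fun ζ => T (ζ + 1)) ζ :=
      DifferentiableAt.comp (g := T) ζ
        (aux_T hkm hkb (ζ := ζ + 1) (by simpa using hζ)).2 (by fun_prop)
    simp only [hA]
    have e1 : DifferentiableAt ℂ (fun ζ : ℂ => -Complex.exp (-(ζ - 1) * δ)) ζ := by fun_prop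
    have e2 : DifferentiableAt ℂ (fun ζ : ℂ => Complex.exp (-(ζ + 1) * δ)) ζ := by fun_prop
    have e3 : DifferentiableAt ℂ (fun ζ : ℂ => Φ (ζ + 1)) ζ := by fun_prop
    have e4 : DifferentiableAt ℂ (fun ζ : ℂ => Φ (ζ - 1)) ζ := by fun_prop
    exact ((((e1.mul t1).add (e2.mul t2)).add e3).sub e4).const_mul _
  · intro ζ hζ hpos
    obtain ⟨iN, eN⟩ := hNk ζ hζ
    obtain ⟨ig, eg⟩ := aux_g hδ0 (ζ := ζ) (S := Set.Iic 0) (c := I)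
      (integrableOn_exp_mul_complex_Iic (by simpa using hpos) 0) (fun s => by
        rw [integral_exp_mul_complex_Iic (by simpa using hpos) 0]
        simp only [Complex.ofReal_zero, mul_zero, Complex.exp_zero]
        rw [one_div, mul_inv, inv_neg, Complex.inv_I, neg_neg, div_eq_mul_inv])
    have e : ∫ x, N ζ x / (W x * (1 + Complex.exp (W x))) =
        ∫ x, (N ζ x * k x + (Set.Iic (0:ℝ)).indicator (fun x => N ζ x / W x) x) := by
      congr 1; ext x
      by_cases hx : 0 < x
      · rw [Set.indicator_of_notMem (by simpa using hx)]
        simp only [hk, if_pos hx]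
        rw [div_eq_mul_inv, mul_inv, add_zero]
      · rw [Set.indicator_of_mem (by simpa using hx)]
        simp only [hk, if_neg hx]
        have a1 := (hp x).2.1
        have a2 := (hm x).2.1
        have a3 := hW0 x
        have a4 : Complex.exp (W x) ≠ 0 := Complex.exp_ne_zero _
        rw [Complex.exp_neg] at a2 ⊢
        have a5 : (1 + (Complex.exp (W x))⁻¹)⁻¹ = Complex.exp (W x) / (1 + Complex.exp (W x)) := by
          rw [eq_div_iff a1, inv_mul_eq_iff_eq_mul₀ a2]
          field_simp
          ring
        rw [a5]
        field_simp
        ring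
    have ig2 : Integrable ((Set.Iic (0:ℝ)).indicator (fun x => N ζ x / W x)) :=
      ig.integrable_indicator measurableSet_Iic
    rw [integral_add iN ig2,
      integral_indicator measurableSet_Iic, eN] at e
    rw [aux_J hΦ hpos.ne'] at eg
    change _ = (1 / (2 * (π : ℂ) * I)) * (∫ x, N ζ x / (W x * (1 + Complex.exp (W x)))) - h ζ
    rw [e]
    change ∫ x in Set.Iic 0, N ζ x / W x = _ at eg
    rw [eg]
    simp only [h]
    rw [neg_mul, Complex.I_mul_I]
    ring
  · intro ζ hζ hneg
    obtain ⟨iN, eN⟩ := hNk ζ hζ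
    obtain ⟨ig, eg⟩ := aux_g hδ0 (ζ := ζ) (S := Set.Ioi 0) (c := -I)
      (integrableOn_exp_mul_complex_Ioi (by simpa using hneg) 0) (fun s => by
        rw [integral_exp_mul_complex_Ioi (by simpa using hneg) 0]
        simp only [Complex.ofReal_zero, mul_zero, Complex.exp_zero]
        rw [neg_div, one_div, mul_inv, inv_neg, Complex.inv_I, neg_neg, div_eq_mul_inv, neg_mul])
    have e : ∫ x, N ζ x / (W x * (1 + Complex.exp (-W x))) =
        ∫ x, (-(N ζ x * k x) + (Set.Ioi (0:ℝ)).indicator (fun x => N ζ x / W x) x) := by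
      congr 1; ext x
      by_cases hx : 0 < x
      · rw [Set.indicator_of_mem (by simpa using hx)]
        simp only [hk, if_pos hx]
        have a1 := (hp x).2.1
        have a2 := (hm x).2.1
        have a3 := hW0 x
        have a4 : Complex.exp (W x) ≠ 0 := Complex.exp_ne_zero _
        rw [Complex.exp_neg] at a2 ⊢
        have a5 : (1 + (Complex.exp (W x))⁻¹)⁻¹ = Complex.exp (W x) / (1 + Complex.exp (W x)) := by
          rw [eq_div_iff a1, inv_mul_eq_iff_eq_mul₀ a2]
          field_simp
          ring
        rw [div_eq_mul_inv, mul_inv, a5]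
        field_simp
        ring
      · rw [Set.indicator_of_notMem (by simpa using hx)]
        simp only [hk, if_neg hx]
        rw [div_eq_mul_inv, mul_inv, add_zero, mul_neg, neg_neg]
    have ig2 : Integrable ((Set.Ioi (0:ℝ)).indicator (fun x => N ζ x / W x)) :=
      ig.integrable_indicator measurableSet_Ioi
    have iN2 : Integrable (fun x => -(N ζ x * k x)) := iN.neg
    rw [integral_add iN2 ig2,
      integral_indicator measurableSet_Ioi, integral_neg, eN] at e
    rw [aux_J hΦ hneg.ne] at eg
    change _ = -((1 / (2 * (π : ℂ) * I)) * (∫ x, N ζ x / (W x * (1 + Complex.exp (-W x)))) + h ζ)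
    rw [e]
    change ∫ x in Set.Ioi 0, N ζ x / W x = _ at eg
    rw [eg]
    simp only [h]
    rw [neg_mul_neg, Complex.I_mul_I]
    ring
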